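/- Let Γ be a finitely presented residually finite group with finite symmetric generating set S, let Γ ⊳ Γ_1 ⊳ Γ_2 ⊳ … be a nested sequence of finite-index normal subgroups with ∩_{n=1}^∞ Γ_n = {1} and [Γ:Γ_n] → ∞, let 𝒢 = {G_n} be the graph sequence of Cayley graphs of Γ/Γ_n with respect to the image of S, and let p be a prime. Then β_ℚ(𝒢) ≤ liminf_{n→∞} d_p(Γ_n)/[Γ:Γ_n] = β_{F_p}(𝒢) ≤ c(𝒢) − 1, where d_p(Γ_n) = dim_{F_p} Γ_n/([Γ_n,Γ_n]·Γ_n^p). -/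

import Mathlib

open Filter Function Set
open scoped Classical TensorProduct Pointwise symmDiff

universe u

namespace GraphSeqPaper

/-- The space of `K`-valued antisymmetric functions supported on the (oriented) edges of `G`:
the `K`-vector space spanned by the edges with the convention `(x,y) = -(y,x)`. -/
def edgeSpace (K : Type*) [Field K] {V : Type u} (G : SimpleGraph V) :
    Submodule K (V → V → K) where
  carrier := {f | (∀ x y, ¬ G.Adj x y → f x y = 0) ∧ ∀ x y, f x y = - f y x}
  add_mem' := by
    rintro f g ⟨hf1, hf2⟩ ⟨hg1, hg2⟩
    refine ⟨fun x y h => ?_, fun x y => ?_⟩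
    · simp only [Pi.add_apply, hf1 x y h, hg1 x y h, add_zero]
    · simp only [Pi.add_apply, hf2 x y, hg2 x y]; ring
  zero_mem' := ⟨fun x y _ => rfl, fun x y => by simp⟩
  smul_mem' := by
    rintro c f ⟨hf1, hf2⟩
    refine ⟨fun x y h => ?_, fun x y => ?_⟩
    · simp only [Pi.smul_apply, hf1 x y h, smul_zero]
    · simp only [Pi.smul_apply, hf2 x y, smul_neg]

lemma edgeSpace_mono (K : Type*) [Field K] {V : Type u} {H G : SimpleGraph V}
    (h : H ≤ G) : edgeSpace K H ≤ edgeSpace K G :=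
  fun f hf => ⟨fun x y hxy => hf.1 x y fun ha => hxy (h ha), hf.2⟩

/-- The basis vector of `ε_K` associated to the oriented edge `(x,y)`. -/
noncomputable def edgeVec (K : Type*) [Field K] {V : Type u} (x y : V) : V → V → K :=
  fun a b => if a = x ∧ b = y then (1 : K) else if a = y ∧ b = x then (-1 : K) else 0

/-- The vector of a walk `(x₀, x₁, …, x_l)`, namely `Σ_{i} (x_i, x_{i+1})`. -/
noncomputable def walkVec (K : Type*) [Field K] {V : Type u} {G : SimpleGraph V} :
    ∀ {x y : V}, G.Walk x y → (V → V → K)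
  | _, _, SimpleGraph.Walk.nil => 0
  | _, _, @SimpleGraph.Walk.cons _ _ a b _ _ p => edgeVec K a b + walkVec K p

/-- `C^q_K(G)`: the subspace of `ε_K(G)` spanned by the vectors of cycles of length at most
`q`. -/
noncomputable def cycleSpace (K : Type*) [Field K] {V : Type u} (G : SimpleGraph V) (q : ℕ) :
    Submodule K (V → V → K) :=
  Submodule.span K
    {f | ∃ (x : V) (c : G.Walk x x), c.IsCycle ∧ c.length ≤ q ∧ f = walkVec K c}

/-- A graph sequence: finite simple graphs, of uniformly bounded vertex degrees, whose number
of vertices tends to infinity. -/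
def IsGraphSeq (V : ℕ → Type u) (G : ∀ n, SimpleGraph (V n)) : Prop :=
  (∀ n, Finite (V n)) ∧
    (∃ D : ℕ, ∀ n (x : V n), ((G n).neighborSet x).ncard ≤ D) ∧
      Tendsto (fun n => Nat.card (V n)) atTop atTop

/-- `ℋ ≺ 𝒢`: there is an integer `L > 0` with `d_{G_n}(x,y) ≤ L · d_{H_n}(x,y)` for all `n`
and all vertices `x, y`. -/
def Prec {V : ℕ → Type u} (H G : ∀ n, SimpleGraph (V n)) : Prop :=
  ∃ L : ℕ, 0 < L ∧ ∀ n (x y : V n), (G n).dist x y ≤ L * (H n).dist x y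

/-- `𝒢 ≃ ℋ`: `ℋ ≺ 𝒢` and `𝒢 ≺ ℋ`. -/
def GEquiv {V : ℕ → Type u} (G H : ∀ n, SimpleGraph (V n)) : Prop :=
  Prec H G ∧ Prec G H

/-- The edge number `e(𝒢) = liminf |E(G_n)|/|V(G_n)|`. -/
noncomputable def edgeNum {V : ℕ → Type u} (G : ∀ n, SimpleGraph (V n)) : ℝ :=
  liminf (fun n => ((G n).edgeSet.ncard : ℝ) / (Nat.card (V n) : ℝ)) atTop

/-- The cost `c(𝒢) = inf { e(ℋ) : ℋ ≃ 𝒢 }`. -/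
noncomputable def cost {V : ℕ → Type u} (G : ∀ n, SimpleGraph (V n)) : ℝ :=
  sInf {r : ℝ | ∃ H : ∀ n, SimpleGraph (V n), IsGraphSeq V H ∧ GEquiv G H ∧ r = edgeNum H}

/-- `s^q_K(𝒢) = liminf (|E(G_n)| - dim_K C^q_K(G_n))/|V(G_n)| - 1`. -/
noncomputable def sInv (K : Type*) [Field K] {V : ℕ → Type u}
    (G : ∀ n, SimpleGraph (V n)) (q : ℕ) : ℝ :=
  liminf (fun n =>
    (((G n).edgeSet.ncard : ℝ) - (Module.finrank K (cycleSpace K (G n) q) : ℝ)) /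
      (Nat.card (V n) : ℝ)) atTop - 1

/-- `β_K(𝒢) = inf_q s^q_K(𝒢)`. -/
noncomputable def beta (K : Type*) [Field K] {V : ℕ → Type u}
    (G : ∀ n, SimpleGraph (V n)) : ℝ :=
  ⨅ q : ℕ, sInv K G q

/-- A large girth sequence: for every `k ≥ 1`, all but finitely many `G_n` contain no cycle of
length at most `k`. -/
def LargeGirth {V : ℕ → Type u} (G : ∀ n, SimpleGraph (V n)) : Prop :=
  ∀ k : ℕ, 1 ≤ k → ∃ N : ℕ, ∀ n, N ≤ n →
    ∀ (x : V n) (c : (G n).Walk x x), c.IsCycle → k < c.length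

/-- The set of edges of `G` whose two endpoints lie in different classes of the partition given
by the fibres of `P`. -/
def crossEdges {V : Type u} (G : SimpleGraph V) (P : V → ℕ) : Set (Sym2 V) :=
  {e | e ∈ G.edgeSet ∧ ∃ x ∈ e, ∃ y ∈ e, P x ≠ P y}

/-- Hyperfiniteness of a graph sequence. -/
def Hyperfinite {V : ℕ → Type u} (G : ∀ n, SimpleGraph (V n)) : Prop :=
  ∀ ε : ℝ, 0 < ε → ∃ Kb : ℕ, ∃ P : ∀ n, V n → ℕ,
    (∀ n i, {x : V n | P n x = i}.ncard ≤ Kb) ∧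
      liminf (fun n => ((crossEdges (G n) (P n)).ncard : ℝ) / (Nat.card (V n) : ℝ)) atTop ≤ ε

/-- The Cayley graph of a group with respect to a (symmetric) set `T`:
`x ~ y` iff `x ≠ y` and `y x⁻¹ ∈ T` (or `x y⁻¹ ∈ T`). -/
def cayley (Q : Type u) [Group Q] (T : Set Q) : SimpleGraph Q :=
  SimpleGraph.fromRel (fun x y => y * x⁻¹ ∈ T)

/-- The Cayley graph of the quotient `Γ ⧸ N` with respect to the image of `S`. -/
def cayleyQuot {Γ : Type u} [Group Γ] (N : Subgroup Γ) (hN : N.Normal) (S : Set Γ) :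
    SimpleGraph (Γ ⧸ N) :=
  haveI := hN
  cayley (Γ ⧸ N) ((fun g => (QuotientGroup.mk g : Γ ⧸ N)) '' S)

/-- The minimal number of generators of a group. -/
noncomputable def minGens (Λ : Type u) [Group Λ] : ℕ :=
  sInf {d : ℕ | ∃ T : Set Λ, T.Finite ∧ T.ncard = d ∧ Subgroup.closure T = ⊤}

/-- A group is finitely presented. -/
def FinitelyPresentedGroup (Γ : Type u) [Group Γ] : Prop :=
  ∃ (n : ℕ) (f : FreeGroup (Fin n) →* Γ) (R : Set (FreeGroup (Fin n))),
    Surjective f ∧ R.Finite ∧ f.ker = Subgroup.normalClosure R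

/-- Amenability via the Følner condition. -/
def IsAmenableFolner (Γ : Type u) [Group Γ] : Prop :=
  ∀ F : Set Γ, F.Finite → ∀ ε : ℝ, 0 < ε →
    ∃ A : Set Γ, A.Finite ∧ A.Nonempty ∧
      ∀ s ∈ F, (((s • A) ∆ A).ncard : ℝ) ≤ ε * A.ncard

/-- The set of edges of `G` joining `F` to its complement. -/
def edgeBoundary {V : Type u} (G : SimpleGraph V) (F : Set V) : Set (Sym2 V) :=
  {e | e ∈ G.edgeSet ∧ ∃ x ∈ e, ∃ y ∈ e, x ∈ F ∧ y ∉ F}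

section Cochains

variable {K : Type*} [Field K] {V : Type u} {G : SimpleGraph V}

/-- The sum of a function on ordered pairs of vertices along a walk. -/
noncomputable def walkSum (f : V → V → K) {x y : V} (p : G.Walk x y) : K :=
  (p.darts.map fun d => f d.fst d.snd).sum

@[simp]
lemma walkSum_nil (f : V → V → K) {x : V} :
    walkSum f (SimpleGraph.Walk.nil : G.Walk x x) = 0 := by
  simp [walkSum]

@[simp]
lemma walkSum_cons (f : V → V → K) {x y z : V} (h : G.Adj x y) (p : G.Walk y z) :
    walkSum f (SimpleGraph.Walk.cons h p) = f x y + walkSum f p := by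
  simp [walkSum]

@[simp]
lemma walkSum_append (f : V → V → K) {x y z : V} (p : G.Walk x y) (q : G.Walk y z) :
    walkSum f (p.append q) = walkSum f p + walkSum f q := by
  simp [walkSum]

lemma walkSum_reverse {f : V → V → K} (hf : ∀ x y, f x y = - f y x) {x y : V}
    (p : G.Walk x y) : walkSum f p.reverse = - walkSum f p := by
  induction p with
  | nil => simp
  | @cons a b c h p ih => simp [ih, hf b a]

lemma walkSum_add (f g : V → V → K) {x y : V} (p : G.Walk x y) :
    walkSum (f + g) p = walkSum f p + walkSum g p := by
  simp [walkSum]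

lemma walkSum_smul (a : K) (f : V → V → K) {x y : V} (p : G.Walk x y) :
    walkSum (a • f) p = a * walkSum f p := by
  simp [walkSum, List.sum_map_mul_left]

variable (K G) in
/-- The `1`-cochains of `G` which vanish on all cycles of length at most `q`. -/
def shortCocycles (q : ℕ) : Submodule K (V → V → K) where
  carrier := {f | f ∈ edgeSpace K G ∧
    ∀ (x : V) (c : G.Walk x x), c.IsCycle → c.length ≤ q → walkSum f c = 0}
  add_mem' := by
    rintro f g ⟨hf, hf'⟩ ⟨hg, hg'⟩
    refine ⟨add_mem hf hg, fun x c hc hq => ?_⟩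
    rw [walkSum_add, hf' x c hc hq, hg' x c hc hq, add_zero]
  zero_mem' := ⟨zero_mem _, fun x c _ _ => by simp [walkSum]⟩
  smul_mem' := by
    rintro a f ⟨hf, hf'⟩
    refine ⟨Submodule.smul_mem _ a hf, fun x c hc hq => ?_⟩
    rw [walkSum_smul, hf' x c hc hq, mul_zero]

lemma _root_.SimpleGraph.Walk.IsPath.eq_cons_nil_of_mem_edges {x y : V} {p : G.Walk y x}
    (hp : p.IsPath) (he : s(x, y) ∈ p.edges) : ∃ h : G.Adj y x, p = .cons h .nil := by
  cases p with
  | nil => simp at he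
  | @cons _ w _ h p =>
    rw [SimpleGraph.Walk.cons_isPath_iff] at hp
    rw [SimpleGraph.Walk.edges_cons, List.mem_cons] at he
    rcases he with he | he
    · have hw : x = w := by
        rcases Sym2.eq_iff.1 he with ⟨h1, h2⟩ | ⟨h1, -⟩
        · exact h1.trans h2
        · exact h1
      subst hw
      have : p = .nil := by simpa using hp.1
      exact ⟨h, by rw [this]⟩
    · exact absurd (p.snd_mem_support_of_mem_edges he) hp.2

lemma walkSum_bypass {q : ℕ} {f : V → V → K} (hf : f ∈ shortCocycles K G q) {x y : V}
    (p : G.Walk x y) (hp : p.length ≤ q) : walkSum f p.bypass = walkSum f p := by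
  induction p with
  | nil => simp [SimpleGraph.Walk.bypass]
  | @cons a b c h p ih =>
    rw [SimpleGraph.Walk.length_cons] at hp
    have ih := ih (by omega)
    simp only [SimpleGraph.Walk.bypass]
    split_ifs with hs
    · have hsplit := congrArg (walkSum f) (p.bypass.take_spec hs)
      rw [walkSum_append, ih] at hsplit
      rw [walkSum_cons, ← hsplit, ← add_assoc, eq_comm, add_eq_right]
      have hpath : (p.bypass.takeUntil a hs).IsPath := p.bypass_isPath.takeUntil hs
      have hlen : (p.bypass.takeUntil a hs).length ≤ p.length :=
        (p.bypass.length_takeUntil_le_length hs).trans p.length_bypass_le_length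
      by_cases he : s(a, b) ∈ (p.bypass.takeUntil a hs).edges
      · obtain ⟨h', hh⟩ := hpath.eq_cons_nil_of_mem_edges he
        rw [hh, walkSum_cons, walkSum_nil, add_zero, hf.1.2 a b, neg_add_cancel]
      · rw [← walkSum_cons (G := G) f h]
        exact hf.2 a _ ((SimpleGraph.Walk.cons_isCycle_iff _ h).2 ⟨hpath, he⟩)
          (by rw [SimpleGraph.Walk.length_cons]; omega)
    · rw [walkSum_cons, walkSum_cons, ih]

/-- Short cocycles vanish on all short closed walks, not only on cycles. -/
lemma walkSum_closed {q : ℕ} {f : V → V → K} (hf : f ∈ shortCocycles K G q) {x : V}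
    (p : G.Walk x x) (hp : p.length ≤ q) : walkSum f p = 0 := by
  have : p.bypass = .nil := by simpa using p.bypass_isPath
  rw [← walkSum_bypass hf p hp, this, walkSum_nil]

lemma walkSum_congr {q : ℕ} {f : V → V → K} (hf : f ∈ shortCocycles K G q) {x y : V}
    (p p' : G.Walk x y) (hp : p.length + p'.length ≤ q) : walkSum f p = walkSum f p' := by
  have := walkSum_closed hf (p.append p'.reverse) (by simpa using hp)
  rwa [walkSum_append, walkSum_reverse hf.1.2, ← sub_eq_add_neg, sub_eq_zero] at this

lemma edgeVec_mem_edgeSpace {x y : V} (h : G.Adj x y) : edgeVec K x y ∈ edgeSpace K G := by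
  have hne := h.ne
  refine ⟨fun a b hab => ?_, fun a b => ?_⟩
  · unfold edgeVec
    rw [if_neg, if_neg]
    · rintro ⟨rfl, rfl⟩; exact hab h.symm
    · rintro ⟨rfl, rfl⟩; exact hab h
  · unfold edgeVec
    split_ifs <;> simp_all

lemma walkVec_mem_edgeSpace {x y : V} (p : G.Walk x y) : walkVec K p ∈ edgeSpace K G := by
  induction p with
  | nil => exact zero_mem _
  | cons h p ih => exact add_mem (edgeVec_mem_edgeSpace h) ih

variable (K G) in
/-- The values of a function on ordered pairs of vertices, at a chosen orientation of
each edge. -/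
noncomputable def edgeCoords : (V → V → K) →ₗ[K] (G.edgeSet → K) where
  toFun f e := f e.1.out.1 e.1.out.2
  map_add' _ _ := rfl
  map_smul' _ _ := rfl

lemma edgeCoords_injOn : Set.InjOn (edgeCoords K G) (edgeSpace K G) := by
  intro f hf g hg hfg
  have key : ∀ x y, G.Adj x y → f x y = g x y := by
    intro x y h
    have h1 := congrFun hfg ⟨s(x, y), h⟩
    have h2 : s((s(x, y)).out.1, (s(x, y)).out.2) = s(x, y) := Quot.out_eq _
    change f (s(x, y)).out.1 (s(x, y)).out.2 = g (s(x, y)).out.1 (s(x, y)).out.2 at h1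
    rcases Sym2.eq_iff.1 h2 with ⟨h3, h4⟩ | ⟨h3, h4⟩
    · rwa [h3, h4] at h1
    · rw [h3, h4] at h1
      rw [hf.2, hg.2, h1]
  funext x y
  by_cases h : G.Adj x y
  · exact key x y h
  · rw [hf.1 x y h, hg.1 x y h]

lemma exists_edgeCoords_eq (a : G.edgeSet → K) : ∃ f ∈ edgeSpace K G, edgeCoords K G f = a := by
  let o : V → V → Prop := fun x y => (s(x, y)).out = (x, y)
  have ho : ∀ {x y}, G.Adj x y → (o x y ↔ ¬ o y x) := by
    intro x y h
    have h2 : s((s(x, y)).out.1, (s(x, y)).out.2) = s(x, y) := Quot.out_eq _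
    have hsw : s(y, x) = s(x, y) := Sym2.eq_swap
    simp only [o, hsw]
    have hne := h.ne
    rcases Sym2.eq_iff.1 h2 with ⟨h3, h4⟩ | ⟨h3, h4⟩
    · simp [Prod.ext_iff, h3, h4, hne]
    · simp [Prod.ext_iff, h3, h4, hne, hne.symm]
  refine ⟨fun x y => if h : G.Adj x y then
    (if o x y then a ⟨s(x, y), h⟩ else - a ⟨s(x, y), h⟩) else 0, ⟨?_, ?_⟩, ?_⟩
  · intro x y h
    simp [h]
  · intro x y
    by_cases h : G.Adj x y
    · have hsw : (⟨s(y, x), h.symm⟩ : G.edgeSet) = ⟨s(x, y), h⟩ := Subtype.ext Sym2.eq_swap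
      have := ho h
      beta_reduce
      rw [dif_pos h, dif_pos h.symm, hsw]
      by_cases h1 : o x y
      · rw [if_pos h1, if_neg (this.1 h1), neg_neg]
      · rw [if_neg h1, if_pos (not_not.1 fun h2 => h1 (this.2 h2))]
    · have h' : ¬ G.Adj y x := fun h' => h h'.symm
      simp [h, h']
  · funext e
    have h2 : s(e.1.out.1, e.1.out.2) = e.1 := Quot.out_eq _
    have h3 : G.Adj e.1.out.1 e.1.out.2 := by
      rw [← SimpleGraph.mem_edgeSet, h2]; exact e.2
    have h4 : o e.1.out.1 e.1.out.2 := by simp only [o, h2]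
    have h5 : (⟨s(e.1.out.1, e.1.out.2), h3⟩ : G.edgeSet) = e := Subtype.ext h2
    change dite _ _ _ = _
    rw [dif_pos h3, if_pos h4, h5]

lemma edgeCoords_dotProduct_edgeVec [Fintype G.edgeSet] {f : V → V → K} (hf : f ∈ edgeSpace K G)
    {x y : V} (h : G.Adj x y) :
    ∑ e, edgeCoords K G (edgeVec K x y) e * edgeCoords K G f e = f x y := by
  rw [Finset.sum_eq_single ⟨s(x, y), h⟩]
  · have h2 : s((s(x, y)).out.1, (s(x, y)).out.2) = s(x, y) := Quot.out_eq _
    change edgeVec K x y (s(x, y)).out.1 (s(x, y)).out.2 * f (s(x, y)).out.1 (s(x, y)).out.2 = _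
    have hne := h.ne
    rcases Sym2.eq_iff.1 h2 with ⟨h3, h4⟩ | ⟨h3, h4⟩
    · rw [h3, h4]; simp [edgeVec]
    · rw [h3, h4, hf.2 x y]; simp [edgeVec, hne.symm]
  · intro e _ he
    have h2 : s(e.1.out.1, e.1.out.2) = e.1 := Quot.out_eq _
    have : edgeCoords K G (edgeVec K x y) e = 0 := by
      change edgeVec K x y e.1.out.1 e.1.out.2 = 0
      unfold edgeVec
      rw [if_neg, if_neg]
      · rintro ⟨h3, h4⟩
        exact he (Subtype.ext (by rw [← h2, h3, h4]; exact Sym2.eq_swap))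
      · rintro ⟨h3, h4⟩
        exact he (Subtype.ext (by rw [← h2, h3, h4]))
    rw [this, zero_mul]
  · simp

lemma edgeCoords_dotProduct_walkVec [Fintype G.edgeSet] {f : V → V → K} (hf : f ∈ edgeSpace K G)
    {x y : V} (p : G.Walk x y) :
    ∑ e, edgeCoords K G (walkVec K p) e * edgeCoords K G f e = walkSum f p := by
  induction p with
  | nil => simp [walkVec]
  | cons h p ih =>
    simp only [walkVec, map_add, Pi.add_apply, add_mul, Finset.sum_add_distrib, ih, walkSum_cons,
      edgeCoords_dotProduct_edgeVec hf h]

lemma cycleSpace_le_edgeSpace (q : ℕ) : cycleSpace K G q ≤ edgeSpace K G := by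
  refine Submodule.span_le.2 ?_
  rintro _ ⟨x, c, -, -, rfl⟩
  exact walkVec_mem_edgeSpace c

lemma cycleSpace_mono {q r : ℕ} (h : q ≤ r) : cycleSpace K G q ≤ cycleSpace K G r := by
  refine Submodule.span_mono ?_
  rintro _ ⟨x, c, hc, hq, rfl⟩
  exact ⟨x, c, hc, hq.trans h, rfl⟩

lemma finrank_map_edgeCoords {W : Submodule K (V → V → K)} (hW : W ≤ edgeSpace K G) :
    Module.finrank K (W.map (edgeCoords K G)) = Module.finrank K W := by
  have hinj : Injective ((edgeCoords K G).domRestrict W) := by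
    intro a b hab
    exact Subtype.ext (edgeCoords_injOn (hW a.2) (hW b.2) hab)
  rw [← LinearMap.finrank_range_of_inj hinj, LinearMap.range_domRestrict]

lemma finrank_edgeSpace [Finite V] : Module.finrank K (edgeSpace K G) = G.edgeSet.ncard := by
  have : Fintype G.edgeSet := Fintype.ofFinite _
  rw [← finrank_map_edgeCoords (le_refl (edgeSpace K G))]
  have : (edgeSpace K G).map (edgeCoords K G) = ⊤ := by
    rw [eq_top_iff]
    intro a _
    obtain ⟨f, hf, rfl⟩ := exists_edgeCoords_eq (G := G) a
    exact Submodule.mem_map_of_mem hf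
  rw [this, finrank_top, Module.finrank_fintype_fun_eq_card, ← Nat.card_coe_set_eq,
    Nat.card_eq_fintype_card]

lemma finrank_shortCocycles_add [Finite V] (q : ℕ) :
    Module.finrank K (shortCocycles K G q) + Module.finrank K (cycleSpace K G q) =
      G.edgeSet.ncard := by
  have : Fintype G.edgeSet := Fintype.ofFinite _
  have hZ : shortCocycles K G q ≤ edgeSpace K G := fun f hf => hf.1
  rw [← finrank_map_edgeCoords hZ, ← finrank_map_edgeCoords (cycleSpace_le_edgeSpace q)]
  have hcard : Module.finrank K (G.edgeSet → K) = G.edgeSet.ncard := by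
    rw [Module.finrank_fintype_fun_eq_card, ← Nat.card_coe_set_eq, Nat.card_eq_fintype_card]
  rw [← hcard, ← Subspace.finrank_add_finrank_dualAnnihilator_eq
    ((cycleSpace K G q).map (edgeCoords K G)), add_comm]
  congr 1
  let e := (Pi.basisFun K G.edgeSet).toDualEquiv
  have he : ∀ a b, e a b = ∑ i, b i * a i := by
    intro a b
    have : e a b = (Pi.basisFun K G.edgeSet).toDual a b := rfl
    rw [this]
    nth_rw 1 [← (Pi.basisFun K G.edgeSet).sum_repr b]
    simp only [map_sum, map_smul, Module.Basis.toDual_apply_left, smul_eq_mul, Pi.basisFun_repr]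
  rw [← LinearEquiv.finrank_map_eq e]
  refine congrArg (fun W : Submodule K (Module.Dual K (G.edgeSet → K)) => Module.finrank K W) ?_
  ext ℓ
  rw [Submodule.mem_dualAnnihilator]
  constructor
  · rintro ⟨_, ⟨f, hf, rfl⟩, rfl⟩ _ ⟨g, hg, rfl⟩
    refine Submodule.span_induction (p := fun g _ => e (edgeCoords K G f) (edgeCoords K G g) = 0)
      ?_ ?_ ?_ ?_ hg
    · rintro _ ⟨x, c, hc, hq, rfl⟩
      rw [he, edgeCoords_dotProduct_walkVec hf.1, hf.2 x c hc hq]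
    · simp
    · intro a b _ _ ha hb
      rw [map_add, map_add, ha, hb, add_zero]
    · intro a b _ hb
      rw [map_smul, map_smul, hb, smul_zero]
  · intro h
    obtain ⟨a, rfl⟩ := e.surjective ℓ
    obtain ⟨f, hf, rfl⟩ := exists_edgeCoords_eq (G := G) a
    refine Submodule.mem_map_of_mem (Submodule.mem_map_of_mem ⟨hf, fun x c hc hq => ?_⟩)
    rw [← edgeCoords_dotProduct_walkVec hf, ← he]
    exact h _ (Submodule.mem_map_of_mem (Submodule.subset_span ⟨x, c, hc, hq, rfl⟩))

end Cochains

section Comparison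

variable {K : Type*} [Field K] {V : Type u} {G H : SimpleGraph V}

/-- If `G` and `H` are `L`-Lipschitz equivalent, then short cocycles on `G` embed in the
`1`-cochains of `H`. -/
lemma finrank_shortCocycles_le [Finite V] {L : ℕ}
    (hGH : ∀ x y, H.Adj x y → ∃ p : G.Walk x y, p.length ≤ L)
    (hHG : ∀ x y, G.Adj x y → ∃ p : H.Walk x y, p.length ≤ L) :
    Module.finrank K (shortCocycles K G (2 * L + L * L + 1)) ≤ H.edgeSet.ncard := by
  choose P hP using hGH
  let I : (V → V → K) →ₗ[K] (V → V → K) :=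
    { toFun := fun f x y => if h : H.Adj x y then walkSum f (P x y h) else 0
      map_add' := by
        intro f g
        funext x y
        by_cases h : H.Adj x y <;> simp [h, walkSum_add]
      map_smul' := by
        intro a f
        funext x y
        by_cases h : H.Adj x y <;> simp [h, walkSum_smul] }
  have hI : ∀ f x y (h : H.Adj x y), I f x y = walkSum f (P x y h) := by
    intro f x y h
    simp [I, h]
  have hI0 : ∀ f x y, ¬ H.Adj x y → I f x y = 0 := by
    intro f x y h
    simp [I, h]
  set Z := shortCocycles K G (2 * L + L * L + 1) with hZ
  have hlift : ∀ f x y (p : H.Walk x y), ∃ p' : G.Walk x y, p'.length ≤ L * p.length ∧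
      walkSum f p' = walkSum (I f) p := by
    intro f x y p
    induction p with
    | nil => exact ⟨.nil, by simp, by simp⟩
    | @cons a b c h p ih =>
      obtain ⟨p', hl, hs⟩ := ih
      refine ⟨(P a b h).append p', ?_, ?_⟩
      · have := hP a b h
        rw [SimpleGraph.Walk.length_append, SimpleGraph.Walk.length_cons, mul_add]
        omega
      · rw [walkSum_append, walkSum_cons, hs, hI _ _ _ h]
  have hinj : Injective (I.domRestrict Z) := by
    rw [← LinearMap.ker_eq_bot, LinearMap.ker_eq_bot']
    rintro ⟨f, hf⟩ h0
    replace h0 : I f = 0 := h0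
    refine Subtype.ext (funext fun x => funext fun y => ?_)
    by_cases h : G.Adj x y
    · obtain ⟨p, hp⟩ := hHG x y h
      obtain ⟨p', hl, hs⟩ := hlift f x y p
      have h1 : walkSum f p' = 0 := by
        rw [hs, h0]
        simp [walkSum]
      have h2 : L * p.length ≤ L * L := Nat.mul_le_mul_left _ hp
      have h3 := walkSum_congr hf (.cons h .nil) p' (by
        simp only [SimpleGraph.Walk.length_cons, SimpleGraph.Walk.length_nil]; omega)
      simpa [h1] using h3
    · exact hf.1.1 x y h
  rw [← LinearMap.finrank_range_of_inj hinj, ← finrank_edgeSpace (K := K)]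
  refine Submodule.finrank_mono ?_
  rintro _ ⟨⟨f, hf⟩, rfl⟩
  refine ⟨fun x y h => hI0 f x y h, fun x y => ?_⟩
  change I f x y = - I f y x
  by_cases h : H.Adj x y
  · rw [hI _ _ _ h, hI _ _ _ h.symm, ← walkSum_reverse hf.1.2]
    refine walkSum_congr hf _ _ ?_
    have h1 := hP _ _ h
    have h2 := hP _ _ h.symm
    rw [SimpleGraph.Walk.length_reverse]
    omega
  · rw [hI0 f x y h, hI0 f y x fun h' => h h'.symm, neg_zero]

end Comparison

section Rational

lemma linearIndependent_intCast {p : ℕ} [hp : Fact p.Prime] {ι X : Type*} {v : ι → X → ℤ}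
    (h : LinearIndependent (ZMod p) fun i x => (v i x : ZMod p)) :
    LinearIndependent ℚ fun i x => (v i x : ℚ) := by
  have hZ : LinearIndependent ℤ v := by
    rw [linearIndependent_iff']
    intro s a ha
    by_contra! hne
    obtain ⟨i, hi, hai⟩ := hne
    obtain ⟨b, hb, hgcd⟩ := s.extract_gcd a ⟨i, hi⟩
    have hg : s.gcd a ≠ 0 := by
      intro h0
      exact hai (by rw [hb i hi, h0, zero_mul])
    have hb0 : ∑ j ∈ s, b j • v j = 0 := by
      have : s.gcd a • ∑ j ∈ s, b j • v j = 0 := by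
        rw [← ha, Finset.smul_sum]
        refine Finset.sum_congr rfl fun j hj => ?_
        rw [smul_smul, ← hb j hj]
      exact (smul_eq_zero.1 this).resolve_left hg
    have hmod := linearIndependent_iff'.1 h s (fun j => (b j : ZMod p)) (by
      funext x
      have := congrArg (Int.cast : ℤ → ZMod p) (congrFun hb0 x)
      simpa [Finset.sum_apply] using this)
    have hdvd : (p : ℤ) ∣ s.gcd b :=
      Finset.dvd_gcd fun j hj => (ZMod.intCast_zmod_eq_zero_iff_dvd _ _).1 (hmod j hj)
    rw [hgcd] at hdvd
    have := Int.natCast_dvd_natCast.1 (by simpa using hdvd : (p : ℤ) ∣ ((1 : ℕ) : ℤ))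
    exact hp.out.one_lt.ne' (Nat.dvd_one.1 this)
  rw [← LinearIndependent.iff_fractionRing ℤ ℚ]
  let φ : (X → ℤ) →ₗ[ℤ] (X → ℚ) := (Int.castAddHom ℚ).toIntLinearMap.compLeft X
  have hφ : LinearMap.ker φ = ⊥ := by
    rw [LinearMap.ker_eq_bot]
    intro a b hab
    funext x
    exact Int.cast_injective (congrFun hab x)
  exact hZ.map' φ hφ

lemma exists_int_walkVec {V : Type u} {G : SimpleGraph V} {x y : V} (c : G.Walk x y) :
    ∃ z : V → V → ℤ, ∀ (K : Type) [Field K], walkVec K c = fun a b => (z a b : K) := by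
  induction c with
  | nil => exact ⟨0, fun K _ => by funext a b; simp [walkVec]⟩
  | @cons u v w h c ih =>
    obtain ⟨z, hz⟩ := ih
    refine ⟨fun a b => (if a = u ∧ b = v then (1 : ℤ) else if a = v ∧ b = u then -1 else 0) + z a b,
      fun K _ => ?_⟩
    funext a b
    simp only [walkVec, hz, Pi.add_apply, edgeVec]
    push_cast
    rfl

lemma finrank_cycleSpace_zmod_le (p : ℕ) [Fact p.Prime] {V : Type u} [Finite V]
    (G : SimpleGraph V) (q : ℕ) :
    Module.finrank (ZMod p) (cycleSpace (ZMod p) G q) ≤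
      Module.finrank ℚ (cycleSpace ℚ G q) := by
  obtain ⟨b, hbs, hspan, hli⟩ := exists_linearIndependent (ZMod p)
    {f | ∃ (x : V) (c : G.Walk x x), c.IsCycle ∧ c.length ≤ q ∧ f = walkVec (ZMod p) c}
  have : Fintype b := (hli.set_finite_of_isNoetherian).fintype
  have hcard : Module.finrank (ZMod p) (cycleSpace (ZMod p) G q) = Fintype.card b := by
    rw [cycleSpace, ← hspan, ← Set.toFinset_card]
    exact finrank_span_set_eq_card hli
  choose x c hc hq hf using fun i : b => hbs i.2
  choose z hz using fun i : b => exists_int_walkVec (c i)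
  have hcurry : ∀ (K : Type) [Field K], LinearIndependent K (fun i => walkVec K (c i)) ↔
      LinearIndependent K (fun i => fun t : V × V => (z i t.1 t.2 : K)) := by
    intro K _
    rw [← (LinearEquiv.curry K K V V).toLinearMap.linearIndependent_iff (LinearEquiv.ker _)]
    simp only [hz]
    rfl
  have hp : LinearIndependent (ZMod p) (fun i => walkVec (ZMod p) (c i)) := by
    have : (fun i => walkVec (ZMod p) (c i)) = ((↑) : b → V → V → ZMod p) :=
      funext fun i => (hf i).symm
    rw [this]; exact hli
  have hQ : LinearIndependent ℚ (fun i => walkVec ℚ (c i)) :=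
    (hcurry ℚ).2 (linearIndependent_intCast ((hcurry (ZMod p)).1 hp))
  rw [hcard, ← finrank_span_eq_card hQ]
  refine Submodule.finrank_mono (Submodule.span_mono ?_)
  rintro _ ⟨i, rfl⟩
  exact ⟨x i, c i, hc i, hq i, rfl⟩

end Rational

section Sequences

variable {K : Type*} [Field K] {V : ℕ → Type u} {G : ∀ n, SimpleGraph (V n)}

lemma ncard_edgeSet_le {W : Type u} [Finite W] {G : SimpleGraph W} {D : ℕ}
    (hD : ∀ x, (G.neighborSet x).ncard ≤ D) : G.edgeSet.ncard ≤ Nat.card W * D := by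
  have : Fintype W := Fintype.ofFinite _
  have h := G.sum_degrees_eq_twice_card_edges
  have h1 : ∑ v, G.degree v ≤ ∑ _v : W, D := by
    refine Finset.sum_le_sum fun v _ => ?_
    rw [← G.card_neighborSet_eq_degree, ← Nat.card_eq_fintype_card, Nat.card_coe_set_eq]
    exact hD v
  rw [Finset.sum_const, smul_eq_mul, Finset.card_univ] at h1
  rw [Nat.card_eq_fintype_card, ← G.coe_edgeFinset, Set.ncard_coe_finset]
  omega

lemma edgeRatio_bounds (hG : IsGraphSeq V G) :
    ∃ D : ℝ, ∀ n, ((G n).edgeSet.ncard : ℝ) / (Nat.card (V n) : ℝ) ≤ D := by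
  obtain ⟨hfin, ⟨D, hD⟩, -⟩ := hG
  refine ⟨D, fun n => ?_⟩
  have := hfin n
  refine div_le_of_le_mul₀ (by positivity) (by positivity) ?_
  rw [mul_comm]
  exact_mod_cast ncard_edgeSet_le (hD n)

/-- The sequence whose lower limit defines `sInv`, in terms of cocycles. -/
lemma cycleDefect_eq (hG : IsGraphSeq V G) (q n : ℕ) :
    ((G n).edgeSet.ncard : ℝ) - (Module.finrank K (cycleSpace K (G n) q) : ℝ) =
      Module.finrank K (shortCocycles K (G n) q) := by
  have := hG.1 n
  rw [← finrank_shortCocycles_add (K := K) (G := G n) q]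
  push_cast
  ring

lemma sInv_eq (hG : IsGraphSeq V G) (q : ℕ) :
    sInv K G q = liminf (fun n => (Module.finrank K (shortCocycles K (G n) q) : ℝ) /
      (Nat.card (V n) : ℝ)) atTop - 1 := by
  simp only [sInv, cycleDefect_eq hG]

lemma shortCocycleRatio_bounds (hG : IsGraphSeq V G) (q : ℕ) :
    ∃ D : ℝ, ∀ n, (Module.finrank K (shortCocycles K (G n) q) : ℝ) /
      (Nat.card (V n) : ℝ) ≤ D := by
  obtain ⟨D, hD⟩ := edgeRatio_bounds hG
  refine ⟨D, fun n => le_trans ?_ (hD n)⟩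
  rw [← cycleDefect_eq hG]
  gcongr
  simp

lemma neg_one_le_sInv (hG : IsGraphSeq V G) (q : ℕ) : -1 ≤ sInv K G q := by
  obtain ⟨D, hD⟩ := shortCocycleRatio_bounds (K := K) hG q
  rw [sInv_eq hG, neg_le_sub_iff_le_add, le_add_iff_nonneg_left]
  exact le_liminf_of_le (isBoundedUnder_of ⟨D, hD⟩).isCoboundedUnder_ge
    (Eventually.of_forall fun n => by positivity)

lemma bddBelow_sInv (hG : IsGraphSeq V G) : BddBelow (Set.range fun q => sInv K G q) :=
  ⟨-1, by rintro _ ⟨q, rfl⟩; exact neg_one_le_sInv hG q⟩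

lemma sInv_antitone (hG : IsGraphSeq V G) : Antitone (sInv K G) := by
  intro q r hqr
  obtain ⟨D, hD⟩ := shortCocycleRatio_bounds (K := K) hG q
  rw [sInv_eq hG, sInv_eq hG]
  refine sub_le_sub_right (liminf_le_liminf (Eventually.of_forall fun n => ?_)
    (isBoundedUnder_of ⟨0, fun n => by positivity⟩)
    (isBoundedUnder_of ⟨D, hD⟩).isCoboundedUnder_ge) 1
  have := hG.1 n
  rw [← cycleDefect_eq hG, ← cycleDefect_eq hG]
  gcongr
  exact Submodule.finrank_mono (cycleSpace_mono hqr)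

lemma beta_rat_le_beta_zmod (p : ℕ) [Fact p.Prime] (hG : IsGraphSeq V G) :
    beta ℚ G ≤ beta (ZMod p) G := by
  refine ciInf_mono (bddBelow_sInv hG) fun q => ?_
  obtain ⟨D, hD⟩ := shortCocycleRatio_bounds (K := ZMod p) hG q
  rw [sInv_eq hG, sInv_eq hG]
  refine sub_le_sub_right (liminf_le_liminf (Eventually.of_forall fun n => ?_)
    (isBoundedUnder_of ⟨0, fun n => by positivity⟩)
    (isBoundedUnder_of ⟨D, hD⟩).isCoboundedUnder_ge) 1
  have := hG.1 n
  rw [← cycleDefect_eq hG, ← cycleDefect_eq hG]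
  gcongr
  exact finrank_cycleSpace_zmod_le p (G n) q

lemma beta_le_edgeNum_sub_one (hG : IsGraphSeq V G) (hconn : ∀ n, (G n).Connected)
    {H : ∀ n, SimpleGraph (V n)} (hH : IsGraphSeq V H) (hGH : GEquiv G H) :
    beta K G ≤ edgeNum H - 1 := by
  obtain ⟨⟨L₁, -, h₁⟩, ⟨L₂, -, h₂⟩⟩ := hGH
  set L := L₁ + L₂
  obtain ⟨D, hD⟩ := edgeRatio_bounds hH
  refine (ciInf_le (bddBelow_sInv hG) (2 * L + L * L + 1)).trans ?_
  rw [sInv_eq hG]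
  refine sub_le_sub_right (liminf_le_liminf (Eventually.of_forall fun n => ?_)
    (isBoundedUnder_of ⟨0, fun n => by positivity⟩)
    (isBoundedUnder_of ⟨D, hD⟩).isCoboundedUnder_ge) 1
  have := hG.1 n
  gcongr
  refine finrank_shortCocycles_le (fun x y h => ?_) (fun x y h => ?_)
  · obtain ⟨p, hp⟩ := (hconn n).exists_walk_length_eq_dist x y
    have := h₁ n x y
    rw [SimpleGraph.dist_eq_one_iff_adj.2 h] at this
    exact ⟨p, by omega⟩
  · have hreach : (H n).Reachable x y := by
      by_contra hr
      have := h₁ n x y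
      rw [SimpleGraph.dist_eq_zero_of_not_reachable hr, mul_zero, Nat.le_zero,
        (hconn n).dist_eq_zero_iff] at this
      exact h.ne this
    obtain ⟨p, hp⟩ := hreach.exists_walk_length_eq_dist
    have := h₂ n x y
    rw [SimpleGraph.dist_eq_one_iff_adj.2 h] at this
    exact ⟨p, by omega⟩

lemma beta_le_cost_sub_one (hG : IsGraphSeq V G) (hconn : ∀ n, (G n).Connected) :
    beta K G ≤ cost G - 1 := by
  rw [le_sub_iff_add_le]
  have hrefl : Prec G G := ⟨1, one_pos, fun n x y => by simp⟩
  refine le_csInf ⟨_, G, hG, ⟨hrefl, hrefl⟩, rfl⟩ ?_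
  rintro _ ⟨H, hH, hGH, rfl⟩
  rw [← le_sub_iff_add_le]
  exact beta_le_edgeNum_sub_one hG hconn hH hGH

end Sequences

section Group

variable {Γ : Type u} [Group Γ]

/-- The elements of `Γ` which are products of at most `q` elements of `S`. -/
def wordBall (S : Set Γ) (q : ℕ) : Set Γ :=
  {g | ∃ l : List S, l.length ≤ q ∧ (l.map ((↑) : S → Γ)).prod = g}

lemma finite_wordBall {S : Set Γ} (hS : S.Finite) (q : ℕ) : (wordBall S q).Finite := by
  have : Finite S := hS
  exact (List.finite_length_le S q).image fun l => (l.map ((↑) : S → Γ)).prod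

/-- Finite presentability does not depend on the finite generating set. -/
lemma FinitelyPresentedGroup.exists_relators (hFP : FinitelyPresentedGroup Γ) {α : Type*}
    [Finite α] (π : FreeGroup α →* Γ) (hπ : Surjective π) :
    ∃ R : Set (FreeGroup α), R.Finite ∧ (∀ r ∈ R, π r = 1) ∧
      π.ker ≤ Subgroup.normalClosure R := by
  obtain ⟨m, f, R, hf, hR, hker⟩ := hFP
  choose t ht using fun i => hπ (f (FreeGroup.of i))
  choose u hu using fun a => hf (π (FreeGroup.of a))
  let θ : FreeGroup (Fin m) →* FreeGroup α := FreeGroup.lift t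
  let τ : FreeGroup α →* FreeGroup (Fin m) := FreeGroup.lift u
  have hθ : π.comp θ = f := by
    ext i
    simp [θ, ht]
  have hτ : f.comp τ = π := by
    ext a
    simp [τ, hu]
  let R' : Set (FreeGroup α) :=
    θ '' R ∪ Set.range fun a => (FreeGroup.of a)⁻¹ * θ (τ (FreeGroup.of a))
  refine ⟨R', (hR.image _).union (Set.finite_range _), ?_, fun w hw => ?_⟩
  · rintro _ (⟨r, hr, rfl⟩ | ⟨a, rfl⟩)
    · have : f r = 1 := by
        rw [← MonoidHom.mem_ker, hker]
        exact Subgroup.subset_normalClosure hr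
      rwa [← hθ] at this
    · have h1 : π (θ (τ (FreeGroup.of a))) = f (τ (FreeGroup.of a)) := DFunLike.congr_fun hθ _
      have h2 : f (τ (FreeGroup.of a)) = π (FreeGroup.of a) := DFunLike.congr_fun hτ _
      rw [map_mul, map_inv, h1, h2, inv_mul_cancel]
  · have h1 : (QuotientGroup.mk' (Subgroup.normalClosure R')).comp (θ.comp τ) =
        QuotientGroup.mk' (Subgroup.normalClosure R') := by
      ext a
      have : (FreeGroup.of a)⁻¹ * θ (τ (FreeGroup.of a)) ∈ Subgroup.normalClosure R' :=
        Subgroup.subset_normalClosure (Or.inr ⟨a, rfl⟩)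
      exact (QuotientGroup.eq.2 this).symm
    have h2 : τ w ∈ Subgroup.normalClosure R := by
      rw [← hker, MonoidHom.mem_ker]
      exact (DFunLike.congr_fun hτ w).trans hw
    have h3 : Subgroup.normalClosure R ≤ (Subgroup.normalClosure R').comap θ :=
      Subgroup.normalClosure_le_normal fun r hr =>
        Subgroup.subset_normalClosure (Or.inl ⟨r, hr, rfl⟩)
    rw [← QuotientGroup.eq_one_iff]
    exact (DFunLike.congr_fun h1 w).symm.trans ((QuotientGroup.eq_one_iff _).2 (h3 h2))

lemma cayleyQuot_adj {N : Subgroup Γ} [hN : N.Normal] {S : Set Γ} (hS : ∀ s ∈ S, s⁻¹ ∈ S)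
    {x y : Γ ⧸ N} :
    (cayleyQuot N hN S).Adj x y ↔ x ≠ y ∧ ∃ s ∈ S, y = (s : Γ ⧸ N) * x := by
  rw [cayleyQuot, cayley, SimpleGraph.fromRel_adj]
  refine and_congr_right fun _ => ⟨?_, ?_⟩
  · rintro (⟨s, hs, h⟩ | ⟨s, hs, h⟩)
    · exact ⟨s, hs, by rw [show (s : Γ ⧸ N) = y * x⁻¹ from h, inv_mul_cancel_right]⟩
    · refine ⟨s⁻¹, hS s hs, ?_⟩
      rw [QuotientGroup.mk_inv, show (s : Γ ⧸ N) = x * y⁻¹ from h]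
      group
  · rintro ⟨s, hs, rfl⟩
    exact Or.inl ⟨s, hs, by simp⟩

lemma cayleyQuot_connected {N : Subgroup Γ} [hN : N.Normal] {S : Set Γ}
    (hS : ∀ s ∈ S, s⁻¹ ∈ S) (hgen : Subgroup.closure S = ⊤) :
    (cayleyQuot N hN S).Connected := by
  have h : ∀ g : Γ, ∀ x : Γ ⧸ N, (cayleyQuot N hN S).Reachable x ((g : Γ ⧸ N) * x) := by
    intro g
    have hg : g ∈ Subgroup.closure S := hgen ▸ Subgroup.mem_top g
    induction hg using Subgroup.closure_induction with
    | mem s hs =>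
      intro x
      by_cases hx : x = (s : Γ ⧸ N) * x
      · rw [← hx]
      · exact ((cayleyQuot_adj hS).2 ⟨hx, s, hs, rfl⟩).reachable
    | one => intro x; simp
    | mul a b _ _ ha hb =>
      intro x
      rw [QuotientGroup.mk_mul, mul_assoc]
      exact (hb x).trans (ha _)
    | inv a _ ha =>
      intro x
      simpa using (ha ((a⁻¹ : Γ) * x)).symm
  rw [SimpleGraph.connected_iff]
  refine ⟨fun x y => ?_, ⟨1⟩⟩
  obtain ⟨g, hg⟩ := QuotientGroup.mk_surjective (y * x⁻¹)
  simpa [hg] using h g x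

lemma ncard_neighborSet_cayleyQuot_le {N : Subgroup Γ} [hN : N.Normal] {S : Set Γ}
    (hfin : S.Finite) (hS : ∀ s ∈ S, s⁻¹ ∈ S) (x : Γ ⧸ N) :
    ((cayleyQuot N hN S).neighborSet x).ncard ≤ S.ncard := by
  refine (Set.ncard_le_ncard ?_ (hfin.image fun s : Γ => (s : Γ ⧸ N) * x)).trans
    (Set.ncard_image_le hfin)
  intro y hy
  obtain ⟨-, s, hs, rfl⟩ := (cayleyQuot_adj hS).1 hy
  exact ⟨s, hs, rfl⟩

variable (K : Type) [Field K] (N : Subgroup Γ)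

/-- The functions on `Γ` which are equivariant with respect to an additive character of `N`. -/
def quasiInvariant : Submodule K (Γ → K) where
  carrier := {Φ | ∀ (g : Γ) (h : N), Φ (g * h) = Φ g + Φ h}
  add_mem' := by
    intro a b ha hb g h
    simp only [Pi.add_apply, ha g h, hb g h]
    ring
  zero_mem' := by
    intro g h
    simp
  smul_mem' := by
    intro c a ha g h
    simp only [Pi.smul_apply, ha g h, smul_add]

/-- The additive characters of `N` with values in `K`. -/
def additiveCharacters : Submodule K (N → K) where
  carrier := {χ | ∀ a b : N, χ (a * b) = χ a + χ b}
  add_mem' := by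
    intro a b ha hb g h
    simp only [Pi.add_apply, ha g h, hb g h]
    ring
  zero_mem' := by
    intro g h
    simp
  smul_mem' := by
    intro c a ha g h
    simp only [Pi.smul_apply, ha g h, smul_add]

lemma finrank_additiveCharacters :
    Module.finrank K (additiveCharacters K N) =
      Module.finrank K (K ⊗[ℤ] Additive (Abelianization N)) := by
  rw [← Subspace.dual_finrank_eq (K := K) (V := K ⊗[ℤ] Additive (Abelianization N))]
  let F : (Additive (Abelianization N) →ₗ[ℤ] K) →ₗ[K] (N → K) :=
    { toFun := fun ℓ h => ℓ (Additive.ofMul (Abelianization.of h))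
      map_add' := fun _ _ => rfl
      map_smul' := fun _ _ => rfl }
  have hF : Injective F := by
    intro a b hab
    ext m
    obtain ⟨h, hh⟩ := QuotientGroup.mk_surjective m.toMul
    have := congrFun hab h
    change a (Additive.ofMul (Abelianization.of h)) =
      b (Additive.ofMul (Abelianization.of h)) at this
    rwa [show Abelianization.of h = m.toMul from hh] at this
  have hrange : LinearMap.range F = additiveCharacters K N := by
    ext χ
    constructor
    · rintro ⟨ℓ, rfl⟩ a b
      change ℓ _ = ℓ _ + ℓ _
      rw [map_mul, ofMul_mul, map_add]
    · intro hχ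
      let c : N →* Multiplicative K := MonoidHom.mk' (fun h => Multiplicative.ofAdd (χ h)) hχ
      refine ⟨(MonoidHom.toAdditiveLeft (Abelianization.lift c)).toIntLinearMap, ?_⟩
      funext h
      change Multiplicative.toAdd (Abelianization.lift c (Abelianization.of h)) = χ h
      rw [Abelianization.lift_apply_of]
      rfl
  rw [← hrange, LinearMap.finrank_range_of_inj hF]
  exact (LinearMap.liftBaseChangeEquiv K).finrank_eq

lemma finrank_quasiInvariant [hN : N.Normal] [Finite (Γ ⧸ N)]
    [FiniteDimensional K (quasiInvariant K N)] :
    Module.finrank K (quasiInvariant K N) + 1 =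
      Module.finrank K (K ⊗[ℤ] Additive (Abelianization N)) + Nat.card (Γ ⧸ N) := by
  have : Fintype (Γ ⧸ N) := Fintype.ofFinite _
  let T : (Γ → K) →ₗ[K] (N → K) × ({x : Γ ⧸ N // x ≠ 1} → K) :=
    { toFun := fun Φ => (fun h => Φ h, fun x => Φ x.1.out)
      map_add' := fun _ _ => rfl
      map_smul' := fun _ _ => rfl }
  have hout : ∀ g : Γ, (QuotientGroup.mk g : Γ ⧸ N).out⁻¹ * g ∈ N := by
    intro g
    rw [← QuotientGroup.eq, QuotientGroup.out_eq']
  have hinj : Injective (T.domRestrict (quasiInvariant K N)) := by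
    rw [← LinearMap.ker_eq_bot, LinearMap.ker_eq_bot']
    rintro ⟨Φ, hΦ⟩ h0
    obtain ⟨h1, h2⟩ := Prod.ext_iff.1 h0
    replace h1 : ∀ h : N, Φ h = 0 := fun h => congrFun h1 h
    refine Subtype.ext (funext fun g => ?_)
    change Φ g = 0
    by_cases hg : (g : Γ ⧸ N) = 1
    · exact h1 ⟨g, (QuotientGroup.eq_one_iff g).1 hg⟩
    · have h3 : Φ (g : Γ ⧸ N).out = 0 := congrFun h2 ⟨g, hg⟩
      have h4 := hΦ (g : Γ ⧸ N).out ⟨_, hout g⟩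
      rw [h1, h3, add_zero] at h4
      simpa using h4
  have hrange : (quasiInvariant K N).map T = (additiveCharacters K N).prod ⊤ := by
    ext ⟨χ, a⟩
    constructor
    · rintro ⟨Φ, hΦ, h⟩
      obtain ⟨rfl, -⟩ := Prod.ext_iff.1 h
      exact ⟨fun x y => hΦ x y, trivial⟩
    · rintro ⟨hχ, -⟩
      replace hχ : ∀ a b : N, χ (a * b) = χ a + χ b := hχ
      let Φ : Γ → K := fun g => if hg : (g : Γ ⧸ N) = 1 then
        χ ⟨g, (QuotientGroup.eq_one_iff g).1 hg⟩ else a ⟨g, hg⟩ + χ ⟨_, hout g⟩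
      have hΦN : ∀ h : N, Φ h = χ h := by
        intro h
        simp [Φ]
      refine ⟨Φ, ?_, ?_⟩
      · intro g h
        rw [hΦN]
        have hgh : ((g * h : Γ) : Γ ⧸ N) = g := QuotientGroup.mk_mul_of_mem g h.2
        by_cases hg : (g : Γ ⧸ N) = 1
        · have hg' : ((g * h : Γ) : Γ ⧸ N) = 1 := hgh.trans hg
          simp only [Φ, dif_pos hg, dif_pos hg', ← hχ]
          rfl
        · have hg' : ¬ ((g * h : Γ) : Γ ⧸ N) = 1 := by rwa [hgh]
          simp only [Φ, dif_neg hg, dif_neg hg', add_assoc, ← hχ]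
          congr 2
          · exact Subtype.ext hgh
          · refine Subtype.ext ?_
            simp only [hgh, Subgroup.coe_mul, mul_assoc]
      · refine Prod.ext (funext hΦN) (funext fun x => ?_)
        obtain ⟨x, hx⟩ := x
        have hx' : ¬ (x.out : Γ ⧸ N) = 1 := by rwa [QuotientGroup.out_eq']
        have h1 : χ 1 = 0 := by simpa using hχ 1 1
        change Φ x.out = a ⟨x, hx⟩
        simp only [Φ, dif_neg hx', QuotientGroup.out_eq', inv_mul_cancel]
        change _ + χ 1 = _
        rw [h1, add_zero]
  have hfin := (LinearEquiv.ofInjective _ hinj).finrank_eq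
  have hcharfin : FiniteDimensional K (additiveCharacters K N) := by
    have : FiniteDimensional K ((quasiInvariant K N).map T) := inferInstance
    have h2 : (additiveCharacters K N).prod ⊤ = (quasiInvariant K N).map T := hrange.symm
    have h3 : additiveCharacters K N =
        ((quasiInvariant K N).map T).map (LinearMap.fst K (N → K) _) := by
      rw [hrange, Submodule.prod_map_fst]
    rw [h3]
    infer_instance
  let J := (additiveCharacters K N).subtype.prodMap
    (LinearMap.id : ({x : Γ ⧸ N // x ≠ 1} → K) →ₗ[K] _)
  have hJ : Injective J := (Submodule.injective_subtype _).prodMap injective_id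
  have hJrange : LinearMap.range J = (additiveCharacters K N).prod ⊤ := by
    rw [LinearMap.range_prodMap, Submodule.range_subtype, LinearMap.range_id]
  have hcard : Fintype.card {x : Γ ⧸ N // x ≠ 1} + 1 = Nat.card (Γ ⧸ N) := by
    rw [Nat.card_eq_fintype_card, Fintype.card_subtype_compl, Fintype.card_subtype_eq]
    exact Nat.sub_add_cancel Fintype.card_pos
  rw [hfin, LinearMap.range_domRestrict, hrange, ← hJrange, LinearMap.finrank_range_of_inj hJ,
    Module.finrank_prod, Module.finrank_fintype_fun_eq_card, finrank_additiveCharacters,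
    add_assoc, hcard]

variable {K N} {S : Set Γ}

/-- A short cocycle on a finite quotient of the Cayley graph lifts to a coboundary of `Γ`,
provided the relators of `Γ` are short. -/
lemma exists_quasiInvariant [hN : N.Normal] (hS : ∀ s ∈ S, s⁻¹ ∈ S)
    (hgen : Subgroup.closure S = ⊤) {R : Set (FreeGroup S)} {q : ℕ}
    (hR : ∀ r ∈ R, FreeGroup.lift ((↑) : S → Γ) r = 1) (hRq : ∀ r ∈ R, r.toWord.length ≤ q)
    (hker : (FreeGroup.lift ((↑) : S → Γ)).ker ≤ Subgroup.normalClosure R)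
    {f : Γ ⧸ N → Γ ⧸ N → K} (hf : f ∈ shortCocycles K (cayleyQuot N hN S) q) :
    ∃ Φ ∈ quasiInvariant K N, ∀ s ∈ S, ∀ g : Γ,
      Φ (s * g) - Φ g = f (g : Γ ⧸ N) ((s * g : Γ) : Γ ⧸ N) := by
  set π : FreeGroup S →* Γ := FreeGroup.lift ((↑) : S → Γ) with hπ
  have hsurj : Surjective π := by
    rw [← MonoidHom.range_eq_top, hπ, FreeGroup.range_lift_eq_closure, Subtype.range_coe, hgen]
  let σ : S → Equiv.Perm (K × Γ ⧸ N) := fun s =>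
    { toFun := fun t => (t.1 + f t.2 ((s : Γ) * t.2), (s : Γ) * t.2)
      invFun := fun t => (t.1 - f (((s : Γ) : Γ ⧸ N)⁻¹ * t.2) t.2, ((s : Γ) : Γ ⧸ N)⁻¹ * t.2)
      left_inv := fun t => by simp
      right_inv := fun t => by simp }
  let ψ : FreeGroup S →* Equiv.Perm (K × Γ ⧸ N) := FreeGroup.lift σ
  have hstep : ∀ (x y : Γ ⧸ N) (s : Γ), s ∈ S → y = (s : Γ ⧸ N) * x →
      ∃ p : (cayleyQuot N hN S).Walk x y, p.length ≤ 1 ∧ walkSum f p = f x y := by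
    intro x y s hs hxy
    by_cases h : x = y
    · subst h
      refine ⟨.nil, by simp, ?_⟩
      rw [walkSum_nil, hf.1.1 x x (SimpleGraph.irrefl _)]
    · exact ⟨.cons ((cayleyQuot_adj hS).2 ⟨h, s, hs, hxy⟩) .nil, by simp, by simp⟩
  have hwalk : ∀ (l : List (S × Bool)) (x : Γ ⧸ N),
      ∃ (y : Γ ⧸ N) (p : (cayleyQuot N hN S).Walk x y), y = (π (FreeGroup.mk l) : Γ) * x ∧
      p.length ≤ l.length ∧ ∀ k, ψ (FreeGroup.mk l) (k, x) = (k + walkSum f p, y) := by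
    intro l
    induction l with
    | nil =>
      intro x
      refine ⟨x, .nil, ?_, by simp, ?_⟩
      · rw [← FreeGroup.one_eq_mk, map_one, QuotientGroup.mk_one, one_mul]
      · intro k
        rw [← FreeGroup.one_eq_mk, map_one, walkSum_nil, add_zero]
        rfl
    | cons a l ih =>
      intro x
      obtain ⟨y, p, hy, hp, hψ⟩ := ih x
      have hmk : FreeGroup.mk (a :: l) = FreeGroup.mk [a] * FreeGroup.mk l := by
        rw [FreeGroup.mul_mk]; rfl
      obtain ⟨s, b⟩ := a
      have hone : ∃ (z : Γ ⧸ N) (p' : (cayleyQuot N hN S).Walk y z),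
          z = (π (FreeGroup.mk [(s, b)]) : Γ) * y ∧ p'.length ≤ 1 ∧
          ∀ k, ψ (FreeGroup.mk [(s, b)]) (k, y) = (k + walkSum f p', z) := by
        cases b with
        | true =>
          have h1 : π (FreeGroup.mk [(s, true)]) = s := FreeGroup.lift_apply_of
          have h2 : ψ (FreeGroup.mk [(s, true)]) = σ s := FreeGroup.lift_apply_of
          rw [h1, h2]
          obtain ⟨p', hp', hs'⟩ := hstep y _ s s.2 rfl
          exact ⟨_, p', rfl, hp', fun k => by rw [hs']; rfl⟩
        | false =>
          have h0 : FreeGroup.mk [(s, false)] = (FreeGroup.of s)⁻¹ := rfl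
          have h1 : π (FreeGroup.mk [(s, false)]) = (s : Γ)⁻¹ := by
            rw [h0, map_inv, hπ, FreeGroup.lift_apply_of]
          have h2 : ψ (FreeGroup.mk [(s, false)]) = (σ s)⁻¹ := by
            rw [h0, map_inv, FreeGroup.lift_apply_of]
          rw [h1, h2]
          obtain ⟨p', hp', hs'⟩ := hstep y _ (s : Γ)⁻¹ (hS s s.2) rfl
          refine ⟨_, p', rfl, hp', fun k => ?_⟩
          rw [hs', hf.1.2, ← sub_eq_add_neg]
          rfl
      obtain ⟨z, p', hz, hp', hψ'⟩ := hone
      refine ⟨z, p.append p', ?_, ?_, fun k => ?_⟩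
      · rw [hz, hy, hmk, map_mul, QuotientGroup.mk_mul, mul_assoc]
      · rw [SimpleGraph.Walk.length_append, List.length_cons]
        omega
      · rw [hmk, map_mul, Equiv.Perm.mul_apply, hψ, hψ', walkSum_append, add_assoc]
  have hψform : ∀ w x, ∃ c : K, ∀ k, ψ w (k, x) = (k + c, (π w : Γ) * x) := by
    intro w x
    have h := hwalk w.toWord x
    rw [FreeGroup.mk_toWord] at h
    obtain ⟨_, p, rfl, -, h⟩ := h
    exact ⟨_, h⟩
  have hkerψ : π.ker ≤ ψ.ker := by
    refine hker.trans (Subgroup.normalClosure_le_normal fun r hr => ?_)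
    rw [SetLike.mem_coe, MonoidHom.mem_ker]
    ext1 ⟨k, x⟩
    have h := hwalk r.toWord x
    rw [FreeGroup.mk_toWord, hR r hr, QuotientGroup.mk_one, one_mul] at h
    obtain ⟨_, p, rfl, hp, h⟩ := h
    rw [h, walkSum_closed hf p (hp.trans (hRq r hr)), add_zero]
    rfl
  let w : Γ → FreeGroup S := surjInv hsurj
  have hw : ∀ g, π (w g) = g := surjInv_eq hsurj
  have hψeq : ∀ u v, π u = π v → ψ u = ψ v := by
    intro u v h
    have : u * v⁻¹ ∈ ψ.ker := hkerψ (by rw [MonoidHom.mem_ker, map_mul, map_inv, h, mul_inv_cancel])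
    rwa [MonoidHom.mem_ker, map_mul, map_inv, mul_inv_eq_one] at this
  let Φ : Γ → K := fun g => (ψ (w g) (0, 1)).1
  have hΦ : ∀ g k, ψ (w g) (k, 1) = (k + Φ g, (g : Γ ⧸ N)) := by
    intro g k
    obtain ⟨c, hc⟩ := hψform (w g) 1
    simp only [Φ, hc, hw, mul_one, zero_add]
  refine ⟨Φ, fun g h => ?_, fun s hs g => ?_⟩
  · have h1 : ψ (w (g * h)) = ψ (w g) * ψ (w h) := by
      rw [← map_mul]
      exact hψeq _ _ (by rw [map_mul, hw, hw, hw])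
    have h2 : ((h : Γ) : Γ ⧸ N) = 1 := (QuotientGroup.eq_one_iff _).2 h.2
    have h3 := hΦ (g * h) 0
    rw [h1, Equiv.Perm.mul_apply, hΦ, h2, hΦ] at h3
    have := congrArg Prod.fst h3
    simp only [zero_add] at this
    rw [← this, add_comm]
  · have h1 : ψ (w (s * g)) = σ ⟨s, hs⟩ * ψ (w g) := by
      rw [← FreeGroup.lift_apply_of (f := σ), ← map_mul]
      refine hψeq _ _ ?_
      rw [map_mul, hw, hw, hπ, FreeGroup.lift_apply_of]
    have h3 := hΦ (s * g) 0
    rw [h1, Equiv.Perm.mul_apply, hΦ] at h3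
    have : (0 : K) + Φ g + f g ((s : Γ ⧸ N) * g) = 0 + Φ (s * g) := congrArg Prod.fst h3
    rw [QuotientGroup.mk_mul]
    linear_combination -this

/-- The coboundary of a quasi-invariant function on `Γ` descends to a short cocycle on a finite
quotient of the Cayley graph with large injectivity radius. -/
lemma exists_shortCocycle [hN : N.Normal] (hS : ∀ s ∈ S, s⁻¹ ∈ S) {q : ℕ} (hq : 2 ≤ q)
    (hB : ∀ g ∈ N, g ∈ wordBall S q → g = 1) {Φ : Γ → K} (hΦ : Φ ∈ quasiInvariant K N) :
    ∃ f ∈ shortCocycles K (cayleyQuot N hN S) q, ∀ s ∈ S, ∀ g : Γ,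
      f (g : Γ ⧸ N) ((s * g : Γ) : Γ ⧸ N) = Φ (s * g) - Φ g := by
  have hmul : ∀ g h, h ∈ N → Φ (g * h) = Φ g + Φ h := fun g h hh => hΦ g ⟨h, hh⟩
  have hsmall : ∀ s ∈ S, ∀ t ∈ S, (s : Γ ⧸ N) = t → s = t := by
    intro s hs t ht hst
    have h1 : s⁻¹ * t ∈ N := QuotientGroup.eq.1 hst
    have h2 := hB _ h1 ⟨[⟨s⁻¹, hS s hs⟩, ⟨t, ht⟩], by simpa using hq, by simp⟩
    exact inv_mul_eq_one.1 h2
  have hsmall₁ : ∀ s ∈ S, (s : Γ ⧸ N) = 1 → s = 1 := by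
    intro s hs h
    refine hB s ((QuotientGroup.eq_one_iff s).1 h) ⟨[⟨s, hs⟩], ?_, by simp⟩
    simp only [List.length_singleton]
    omega
  have hadj := fun (x y : Γ ⧸ N) (h : (cayleyQuot N hN S).Adj x y) => ((cayleyQuot_adj hS).1 h).2
  choose c hcS hc using hadj
  let f : Γ ⧸ N → Γ ⧸ N → K := fun x y =>
    if h : (cayleyQuot N hN S).Adj x y then Φ (c x y h * x.out) - Φ x.out else 0
  have hf0 : ∀ x y, ¬ (cayleyQuot N hN S).Adj x y → f x y = 0 := fun x y h => dif_neg h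
  have hf : ∀ s ∈ S, ∀ g : Γ, f (g : Γ ⧸ N) ((s * g : Γ) : Γ ⧸ N) = Φ (s * g) - Φ g := by
    intro s hs g
    by_cases h : (cayleyQuot N hN S).Adj (g : Γ ⧸ N) ((s * g : Γ) : Γ ⧸ N)
    · have h1 : c _ _ h = s := by
        refine hsmall _ (hcS _ _ h) _ hs ?_
        have : (s : Γ ⧸ N) * (g : Γ ⧸ N) = (c _ _ h : Γ) * (g : Γ ⧸ N) := hc _ _ h
        exact (mul_right_cancel this).symm
      have h2 : f (g : Γ ⧸ N) ((s * g : Γ) : Γ ⧸ N) =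
          Φ (s * (g : Γ ⧸ N).out) - Φ (g : Γ ⧸ N).out := by
        simp only [f]
        rw [dif_pos h, h1]
      obtain ⟨k, hk⟩ := QuotientGroup.mk_out_eq_mul N g
      rw [h2, hk, ← mul_assoc, hmul _ _ k.2, hmul _ _ k.2]
      ring
    · rw [hf0 _ _ h]
      have h1 : (g : Γ ⧸ N) = ((s * g : Γ) : Γ ⧸ N) := by
        by_contra hne
        exact h ((cayleyQuot_adj hS).2 ⟨hne, s, hs, rfl⟩)
      have h2 : s = 1 := by
        refine hsmall₁ s hs ?_
        rwa [QuotientGroup.mk_mul, right_eq_mul] at h1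
      rw [h2, one_mul, sub_self]
  have hlift : ∀ (x y : Γ ⧸ N) (p : (cayleyQuot N hN S).Walk x y) (g : Γ), (g : Γ ⧸ N) = x →
      ∃ l : List S, l.length = p.length ∧
        (((l.map ((↑) : S → Γ)).prod * g : Γ) : Γ ⧸ N) = y ∧
        walkSum f p = Φ ((l.map ((↑) : S → Γ)).prod * g) - Φ g := by
    intro x y p
    induction p with
    | nil =>
      intro g hg
      exact ⟨[], by simp, by simpa using hg, by simp⟩
    | @cons a b d h p ih =>
      rintro g rfl
      have hb : ((c _ _ h * g : Γ) : Γ ⧸ N) = b := (hc _ _ h).symm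
      obtain ⟨l, hl, hy, hsum⟩ := ih (c _ _ h * g) hb
      refine ⟨l ++ [⟨c _ _ h, hcS _ _ h⟩], by simp [hl], ?_, ?_⟩
      · simpa [mul_assoc] using hy
      · have h1 := hf _ (hcS _ _ h) g
        rw [hb] at h1
        rw [walkSum_cons, hsum, h1]
        simp [mul_assoc]
  refine ⟨f, ⟨⟨hf0, fun x y => ?_⟩, fun x p _ hp => ?_⟩, hf⟩
  · by_cases h : (cayleyQuot N hN S).Adj x y
    · obtain ⟨g, rfl⟩ := QuotientGroup.mk_surjective x
      have hy : y = ((c _ _ h * g : Γ) : Γ ⧸ N) := hc _ _ h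
      have hs := hcS _ _ h
      have h1 := hf _ hs g
      have h2 := hf _ (hS _ hs) (c _ _ h * g)
      rw [inv_mul_cancel_left, ← hy] at h2
      rw [← hy] at h1
      rw [h1, h2]
      ring
    · rw [hf0 x y h, hf0 y x fun h' => h h'.symm, neg_zero]
  · obtain ⟨g, rfl⟩ := QuotientGroup.mk_surjective x
    obtain ⟨l, hl, hy, hsum⟩ := hlift _ _ p g rfl
    have h1 : (l.map ((↑) : S → Γ)).prod = 1 := by
      refine hB _ ?_ ⟨l, hl.trans_le hp, rfl⟩
      rw [← QuotientGroup.eq_one_iff]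
      rwa [QuotientGroup.mk_mul, mul_eq_right] at hy
    rw [hsum, h1, one_mul, sub_self]

lemma finrank_shortCocycles_cayleyQuot [hN : N.Normal] [Finite (Γ ⧸ N)]
    (hS : ∀ s ∈ S, s⁻¹ ∈ S) (hgen : Subgroup.closure S = ⊤) {R : Set (FreeGroup S)} {q : ℕ}
    (hR : ∀ r ∈ R, FreeGroup.lift ((↑) : S → Γ) r = 1) (hRq : ∀ r ∈ R, r.toWord.length ≤ q)
    (hker : (FreeGroup.lift ((↑) : S → Γ)).ker ≤ Subgroup.normalClosure R) (hq : 2 ≤ q)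
    (hB : ∀ g ∈ N, g ∈ wordBall S q → g = 1) :
    Module.finrank K (shortCocycles K (cayleyQuot N hN S) q) + 1 =
      Module.finrank K (K ⊗[ℤ] Additive (Abelianization N)) + Nat.card (Γ ⧸ N) := by
  let A : (Γ ⧸ N → Γ ⧸ N → K) →ₗ[K] (S → Γ → K) :=
    { toFun := fun f s g => f (g : Γ ⧸ N) ((s * g : Γ) : Γ ⧸ N)
      map_add' := fun _ _ => rfl
      map_smul' := fun _ _ => rfl }
  let B : (Γ → K) →ₗ[K] (S → Γ → K) :=
    { toFun := fun Φ s g => Φ (s * g) - Φ g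
      map_add' := fun _ _ => by
        funext s g
        simp only [Pi.add_apply]
        ring
      map_smul' := fun _ _ => by
        funext s g
        simp [mul_sub] }
  have hA : Injective (A.domRestrict (shortCocycles K (cayleyQuot N hN S) q)) := by
    rw [← LinearMap.ker_eq_bot, LinearMap.ker_eq_bot']
    rintro ⟨f, hf⟩ h0
    refine Subtype.ext (funext fun x => funext fun y => ?_)
    change f x y = 0
    by_cases h : (cayleyQuot N hN S).Adj x y
    · obtain ⟨-, s, hs, rfl⟩ := (cayleyQuot_adj hS).1 h
      obtain ⟨g, rfl⟩ := QuotientGroup.mk_surjective x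
      exact congrFun (congrFun h0 ⟨s, hs⟩) g
    · exact hf.1.1 x y h
  have hBinj : Injective (B.domRestrict (quasiInvariant K N)) := by
    rw [← LinearMap.ker_eq_bot, LinearMap.ker_eq_bot']
    rintro ⟨Φ, hΦ⟩ h0
    have hstep : ∀ s ∈ S, ∀ g, Φ (s * g) = Φ g :=
      fun s hs g => sub_eq_zero.1 (congrFun (congrFun h0 ⟨s, hs⟩) g)
    have hinv : ∀ a g, Φ (a * g) = Φ g := by
      intro a
      have ha : a ∈ Subgroup.closure S := hgen ▸ Subgroup.mem_top a
      induction ha using Subgroup.closure_induction with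
      | mem s hs => exact hstep s hs
      | one => simp
      | mul a b _ _ ha hb => intro g; rw [mul_assoc, ha, hb]
      | inv a _ ha => intro g; rw [← ha (a⁻¹ * g), mul_inv_cancel_left]
    have h1 : Φ 1 = 0 := by simpa using hΦ 1 1
    refine Subtype.ext (funext fun g => ?_)
    change Φ g = 0
    rw [← mul_one g, hinv, h1]
  have hrange : (shortCocycles K (cayleyQuot N hN S) q).map A = (quasiInvariant K N).map B := by
    refine le_antisymm ?_ ?_
    · rintro _ ⟨f, hf, rfl⟩
      obtain ⟨Φ, hΦ, h⟩ := exists_quasiInvariant hS hgen hR hRq hker hf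
      exact ⟨Φ, hΦ, funext fun s => funext fun g => h s s.2 g⟩
    · rintro _ ⟨Φ, hΦ, rfl⟩
      obtain ⟨f, hf, h⟩ := exists_shortCocycle hS hq hB hΦ
      exact ⟨f, hf, funext fun s => funext fun g => h s s.2 g⟩
  have hrange' : LinearMap.range (A.domRestrict (shortCocycles K (cayleyQuot N hN S) q)) =
      LinearMap.range (B.domRestrict (quasiInvariant K N)) := by
    rwa [LinearMap.range_domRestrict, LinearMap.range_domRestrict]
  have : FiniteDimensional K (LinearMap.range (B.domRestrict (quasiInvariant K N))) := by
    rw [← hrange']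
    infer_instance
  have : FiniteDimensional K (quasiInvariant K N) :=
    (LinearEquiv.ofInjective _ hBinj).symm.finiteDimensional
  rw [← finrank_quasiInvariant, ← LinearMap.finrank_range_of_inj hA, hrange',
    LinearMap.finrank_range_of_inj hBinj]

end Group

section Main

/-- Adding a null sequence to a bounded sequence does not change the lower limit. -/
lemma liminf_add_of_tendsto_zero {u v : ℕ → ℝ} {a b : ℝ} (ha : ∀ n, a ≤ u n) (hb : ∀ n, u n ≤ b)
    (hv : Tendsto v atTop (nhds 0)) : liminf (u + v) atTop = liminf u atTop := by
  have hu₁ : IsBoundedUnder (· ≥ ·) atTop u := isBoundedUnder_of ⟨a, ha⟩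
  have hu₂ : IsBoundedUnder (· ≤ ·) atTop u := isBoundedUnder_of ⟨b, hb⟩
  have h1 := le_liminf_add hu₁ hu₂ hv.isBoundedUnder_ge hv.isBoundedUnder_le.isCoboundedUnder_ge
  have h2 := liminf_add_le hv.isBoundedUnder_ge hv.isBoundedUnder_le hu₁ hu₂.isCoboundedUnder_ge
  rw [hv.liminf_eq, add_zero] at h1
  rw [hv.limsup_eq, zero_add, add_comm v u] at h2
  exact le_antisymm h2 h1

variable {Γ : Type u} [Group Γ] {S : Set Γ} {N : ℕ → Subgroup Γ}

lemma isGraphSeq_cayleyQuot (hSfin : S.Finite) (hSsym : ∀ s ∈ S, s⁻¹ ∈ S)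
    (hnorm : ∀ n, (N n).Normal) (hfi : ∀ n, (N n).FiniteIndex)
    (hidx : Tendsto (fun n => (N n).index) atTop atTop) :
    IsGraphSeq (fun n => Γ ⧸ N n) (fun n => cayleyQuot (N n) (hnorm n) S) :=
  ⟨fun _ => inferInstance,
    ⟨S.ncard, fun _ x => ncard_neighborSet_cayleyQuot_le hSfin hSsym x⟩, hidx⟩

lemma eventually_forall_mem_eq_one (hnested : ∀ n, N (n + 1) ≤ N n) (hinter : ⨅ n, N n = ⊥)
    {B : Set Γ} (hB : B.Finite) : ∀ᶠ n in atTop, ∀ g ∈ B, g ∈ N n → g = 1 := by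
  have hanti : Antitone N := antitone_nat_of_succ_le hnested
  rw [eventually_all_finite hB]
  intro g _
  by_cases hg : g = 1
  · exact Eventually.of_forall fun _ _ => hg
  · obtain ⟨m, hm⟩ : ∃ m, g ∉ N m := by
      by_contra! h
      have : g ∈ ⨅ n, N n := Subgroup.mem_iInf.2 h
      rw [hinter, Subgroup.mem_bot] at this
      exact hg this
    filter_upwards [eventually_ge_atTop m] with n hn hgn
    exact absurd (hanti hn hgn) hm

lemma beta_eq_liminf_finrank (K : Type) [Field K]
    (hSfin : S.Finite) (hSsym : ∀ s ∈ S, s⁻¹ ∈ S) (hSgen : Subgroup.closure S = ⊤)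
    (hnorm : ∀ n, (N n).Normal)
    (hnested : ∀ n, N (n + 1) ≤ N n) (hfi : ∀ n, (N n).FiniteIndex)
    (hinter : ⨅ n, N n = ⊥)
    (hidx : Tendsto (fun n => (N n).index) atTop atTop)
    (hFP : FinitelyPresentedGroup Γ) :
    beta K (fun n => cayleyQuot (N n) (hnorm n) S) =
      liminf (fun n => (Module.finrank K (K ⊗[ℤ] Additive (Abelianization (N n))) : ℝ) /
        ((N n).index : ℝ)) atTop := by
  have hG := isGraphSeq_cayleyQuot hSfin hSsym hnorm hfi hidx
  have : Finite S := hSfin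
  obtain ⟨R, hRfin, hR, hker⟩ := hFP.exists_relators (FreeGroup.lift ((↑) : S → Γ)) (by
    rw [← MonoidHom.range_eq_top, FreeGroup.range_lift_eq_closure, Subtype.range_coe, hSgen])
  obtain ⟨q₀, hq₀⟩ := (hRfin.image fun r => r.toWord.length).bddAbove
  have hconst : ∀ q, 2 ≤ q → q₀ ≤ q → sInv K (fun n => cayleyQuot (N n) (hnorm n) S) q =
      liminf (fun n => (Module.finrank K (K ⊗[ℤ] Additive (Abelianization (N n))) : ℝ) /
        ((N n).index : ℝ)) atTop := by
    intro q hq hqq₀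
    obtain ⟨D, hD⟩ := shortCocycleRatio_bounds (K := K) hG q
    have hv : Tendsto (fun n => ((N n).index : ℝ)⁻¹) atTop (nhds 0) :=
      tendsto_inv_atTop_zero.comp (tendsto_natCast_atTop_atTop.comp hidx)
    rw [sInv_eq hG, ← liminf_add_of_tendsto_zero (fun n => by positivity) hD hv, sub_eq_add_neg,
      ← liminf_add_const]
    · refine liminf_congr ?_
      filter_upwards [eventually_forall_mem_eq_one hnested hinter (finite_wordBall hSfin q)]
        with n hn
      have hN := hnorm n
      have hfin := hG.1 n
      have h := finrank_shortCocycles_cayleyQuot (K := K) hSsym hSgen hR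
        (fun r hr => (hq₀ ⟨r, hr, rfl⟩).trans hqq₀) hker hq fun g hg hgB => hn g hgB hg
      have hcard : Nat.card (Γ ⧸ N n) = (N n).index := rfl
      have hpos : ((N n).index : ℝ) ≠ 0 := Nat.cast_ne_zero.2 (hfi n).index_ne_zero
      rw [hcard] at h
      have h' : (Module.finrank K (shortCocycles K (cayleyQuot (N n) (hnorm n) S) q) : ℝ) + 1 =
        Module.finrank K (K ⊗[ℤ] Additive (Abelianization (N n))) + (N n).index := by
        exact_mod_cast h
      simp only [Pi.add_apply, hcard]
      field_simp
      linear_combination h'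
    · refine (isBoundedUnder_of ⟨D + 1, fun n => ?_⟩ :
        IsBoundedUnder (· ≤ ·) atTop _).isCoboundedUnder_ge
      exact add_le_add (hD n) (Nat.cast_inv_le_one _)
    · exact isBoundedUnder_of ⟨0, fun n => add_nonneg (by positivity) (by positivity)⟩
  refine le_antisymm ?_ (le_ciInf fun q => ?_)
  · rw [← hconst (2 + q₀) (by omega) (by omega)]
    exact ciInf_le (bddBelow_sInv hG) _
  · rw [← hconst (2 + q₀ + q) (by omega) (by omega)]
    exact sInv_antitone hG (by omega)

end Main

theorem beta_rat_le_mod_p_gradient_le_cost (p : ℕ) [Fact p.Prime] {Γ : Type u} [Group Γ] (S : Set Γ)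
    (hSfin : S.Finite) (hSsym : ∀ s ∈ S, s⁻¹ ∈ S) (hSgen : Subgroup.closure S = ⊤)
    (N : ℕ → Subgroup Γ) (hnorm : ∀ n, (N n).Normal)
    (hnested : ∀ n, N (n + 1) ≤ N n) (hfi : ∀ n, (N n).FiniteIndex)
    (hinter : ⨅ n, N n = ⊥)
    (hidx : Tendsto (fun n => (N n).index) atTop atTop)
    (hFP : FinitelyPresentedGroup Γ) :
    beta ℚ (fun n => cayleyQuot (N n) (hnorm n) S) ≤
        liminf (fun n =>
          (Module.finrank (ZMod p) (ZMod p ⊗[ℤ] Additive (Abelianization ↥(N n))) : ℝ) /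
            ((N n).index : ℝ)) atTop ∧
      liminf (fun n =>
          (Module.finrank (ZMod p) (ZMod p ⊗[ℤ] Additive (Abelianization ↥(N n))) : ℝ) /
            ((N n).index : ℝ)) atTop =
        beta (ZMod p) (fun n => cayleyQuot (N n) (hnorm n) S) ∧
      beta (ZMod p) (fun n => cayleyQuot (N n) (hnorm n) S) ≤
        cost (fun n => cayleyQuot (N n) (hnorm n) S) - 1 := by
  have hG := isGraphSeq_cayleyQuot hSfin hSsym hnorm hfi hidx
  have hβ := beta_eq_liminf_finrank (ZMod p) hSfin hSsym hSgen hnorm hnested hfi hinter hidx hFP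
  refine ⟨?_, hβ.symm, ?_⟩
  · rw [← hβ]
    exact beta_rat_le_beta_zmod p hG
  · exact beta_le_cost_sub_one hG fun n => cayleyQuot_connected (hN := hnorm n) hSsym hSgen

end GraphSeqPaper
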